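/- arXiv:2210.06691 — 4 statements merged into one kernel-verified Lean document; each statement's English description precedes it below -/
import Mathlib

section
/- For |c| < 2/(3√3), let r(c) denote the unique solution of x³ − x = c in the interval (−1/√3, 1/√3). Fix a nonnegative integer n, let λₙ = π/2 + nπ and εₙ⁰ = 1/λₙ, and define Hₙ(μ, ε) = λₙ² − 1/ε² + 3·r(μ·ε²)²/ε² for ε > 0 and μ with |μ·ε²| < 2/(3√3). Then there exist μ̄ > 0, ρ > 0 and C > 0 such that for every μ with |μ| < μ̄, there is a unique ε ∈ (εₙ⁰ − ρ, εₙ⁰ + ρ) with Hₙ(μ, ε) = 0, and this ε satisfies |ε − εₙ⁰| ≤ C·μ². -/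
lemma ch_r_small (r : ℝ → ℝ)
    (hr : ∀ c : ℝ, |c| < 2 / (3 * Real.sqrt 3) →
      r c ∈ Set.Ioo (-(1 / Real.sqrt 3)) (1 / Real.sqrt 3) ∧ (r c) ^ 3 - r c = c)
    (c : ℝ) (hc : |c| ≤ 1 / 20) :
    |r c| ≤ 3 / 2 * |c| ∧ (r c) ^ 3 - r c = c := by
  have h3 : (0:ℝ) < Real.sqrt 3 := by positivity
  have h3' : Real.sqrt 3 ^ 2 = 3 := Real.sq_sqrt (by norm_num)
  have h32 : Real.sqrt 3 < 2 := by nlinarith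
  have hlt : |c| < 2 / (3 * Real.sqrt 3) := by
    rw [lt_div_iff₀ (by positivity)]
    nlinarith [abs_nonneg c]
  obtain ⟨⟨h1, h2⟩, h⟩ := hr c hlt
  refine ⟨?_, h⟩
  have hab : |r c| < 1 / Real.sqrt 3 := abs_lt.2 ⟨h1, h2⟩
  have hsq : |r c| ^ 2 ≤ 1 / 3 := by
    have : |r c| ^ 2 ≤ (1 / Real.sqrt 3) ^ 2 := by gcongr
    rwa [div_pow, h3', one_pow] at this
  have hc' : |c| = |r c| * (1 - |r c| ^ 2) := by
    have : c = - (r c * (1 - |r c| ^ 2)) := by rw [sq_abs]; linarith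
    conv_lhs => rw [this]
    rw [abs_neg, abs_mul, abs_of_nonneg (a := 1 - |r c| ^ 2) (by linarith)]
  rw [hc']
  nlinarith [abs_nonneg (r c)]

lemma ch_r_lip (r : ℝ → ℝ)
    (hr : ∀ c : ℝ, |c| < 2 / (3 * Real.sqrt 3) →
      r c ∈ Set.Ioo (-(1 / Real.sqrt 3)) (1 / Real.sqrt 3) ∧ (r c) ^ 3 - r c = c)
    (c d : ℝ) (hc : |c| ≤ 1 / 20) (hd : |d| ≤ 1 / 20) :
    |r c - r d| ≤ 2 * |c - d| := by
  obtain ⟨a1, a2⟩ := ch_r_small r hr c hc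
  obtain ⟨b1, b2⟩ := ch_r_small r hr d hd
  have a3 := abs_le.1 (show |r c| ≤ 3/40 by linarith)
  have b3 := abs_le.1 (show |r d| ≤ 3/40 by linarith)
  have key : c - d = -((r c - r d) * (1 - (r c^2 + r c * r d + r d ^2))) := by
    linear_combination b2 - a2
  have hq : 1/2 ≤ 1 - (r c^2 + r c * r d + r d ^2) := by nlinarith
  have hk : |c - d| = |r c - r d| * (1 - (r c^2 + r c * r d + r d ^2)) := by
    rw [key, abs_neg, abs_mul,
      abs_of_nonneg (a := 1 - (r c^2 + r c * r d + r d ^2)) (by linarith)]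
  rw [hk]
  nlinarith [abs_nonneg (r c - r d)]

lemma ch_aux (L e : ℝ) (he : 0 < e) (hL : 0 < L) (hLe : L * e = 1) (r : ℝ → ℝ)
    (hr : ∀ c : ℝ, |c| < 2 / (3 * Real.sqrt 3) →
      r c ∈ Set.Ioo (-(1 / Real.sqrt 3)) (1 / Real.sqrt 3) ∧ (r c) ^ 3 - r c = c) :
    ∃ μbar > (0 : ℝ), ∃ ρ > (0 : ℝ), ∃ C > (0 : ℝ), ∀ μ : ℝ, |μ| < μbar →
      (∃! ε : ℝ, ε ∈ Set.Ioo (e - ρ) (e + ρ) ∧ 0 < ε ∧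
          L ^ 2 - 1 / ε ^ 2 + 3 * (r (μ * ε ^ 2)) ^ 2 / ε ^ 2 = 0) ∧
      ∀ ε : ℝ, ε ∈ Set.Ioo (e - ρ) (e + ρ) → 0 < ε →
          L ^ 2 - 1 / ε ^ 2 + 3 * (r (μ * ε ^ 2)) ^ 2 / ε ^ 2 = 0 →
          |ε - e| ≤ C * μ ^ 2 := by
  refine ⟨L^2/50, by positivity, e/2, by positivity, 40*e^5, by positivity, ?_⟩
  intro μ hμ
  have hL2 : L^2 * e^2 = 1 := by rw [← mul_pow, hLe, one_pow]
  have hG : ∀ ε : ℝ, 0 < ε → (L ^ 2 - 1 / ε ^ 2 + 3 * (r (μ * ε ^ 2)) ^ 2 / ε ^ 2 = 0 ↔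
      L^2 * ε^2 + 3 * (r (μ * ε ^ 2)) ^ 2 - 1 = 0) := by
    intro ε h
    have : L ^ 2 - 1 / ε ^ 2 + 3 * (r (μ * ε ^ 2)) ^ 2 / ε ^ 2 =
      (L^2 * ε^2 + 3 * (r (μ * ε ^ 2)) ^ 2 - 1) / ε^2 := by field_simp; ring
    rw [this, div_eq_zero_iff]
    have : ε^2 ≠ 0 := by positivity
    tauto
  have hsm : ∀ ε : ℝ, 0 < ε → ε < 3/2 * e → |μ * ε^2| ≤ 1/20 := by
    intro ε h1 h2
    rw [abs_mul, abs_of_nonneg (sq_nonneg ε)]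
    have : ε^2 ≤ (3/2*e)^2 := by gcongr
    calc |μ| * ε^2 ≤ (L^2/50) * (3/2*e)^2 := by gcongr
      _ = 9/200 * (L^2 * e^2) := by ring
      _ ≤ 1/20 := by rw [hL2]; norm_num
  have hmono : ∀ a b : ℝ, 0 < a → a < b → b < 3/2*e →
      L^2 * a^2 + 3 * (r (μ * a ^ 2)) ^ 2 - 1 < L^2 * b^2 + 3 * (r (μ * b ^ 2)) ^ 2 - 1 := by
    intro a b ha hab hb
    have ca := hsm a ha (by linarith)
    have cb := hsm b (by linarith) hb
    have l := ch_r_lip r hr _ _ ca cb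
    have a3 := (ch_r_small r hr _ ca).1
    have b3 := (ch_r_small r hr _ cb).1
    have hs : 0 < b^2 - a^2 := by nlinarith
    have e1 : |μ * a^2 - μ * b^2| = |μ| * (b^2 - a^2) := by
      rw [← mul_sub, abs_mul, abs_sub_comm, abs_of_pos hs]
    rw [e1] at l
    have e2 : |r (μ*a^2) + r (μ*b^2)| ≤ 1 := (abs_add_le _ _).trans (by linarith)
    have e3 : r (μ*a^2)^2 - r (μ*b^2)^2 ≤ 2 * (|μ| * (b^2 - a^2)) := by
      calc r (μ*a^2)^2 - r (μ*b^2)^2 ≤ |r (μ*a^2)^2 - r (μ*b^2)^2| := le_abs_self _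
        _ = |r (μ*a^2) - r (μ*b^2)| * |r (μ*a^2) + r (μ*b^2)| := by
            rw [← abs_mul]; congr 1; ring
        _ ≤ |r (μ*a^2) - r (μ*b^2)| * 1 := by gcongr
        _ ≤ _ := by linarith
    have e4 : |μ| * (b^2 - a^2) ≤ L^2/50 * (b^2 - a^2) := by gcongr
    have e5 : 0 < L^2 * (b^2 - a^2) := by positivity
    linarith
  constructor
  · have hcont : ContinuousOn (fun ε => L^2 * ε^2 + 3 * (r (μ * ε ^ 2)) ^ 2 - 1)
        (Set.Icc (3/4*e) e) := by
      have hrc : ContinuousOn r (Set.Icc (-(1/20)) (1/20)) := by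
        apply LipschitzOnWith.continuousOn (K := 2)
        apply LipschitzOnWith.of_dist_le_mul
        intro x hx y hy
        simpa [Real.dist_eq] using ch_r_lip r hr x y (abs_le.2 hx) (abs_le.2 hy)
      have : ContinuousOn (fun ε => r (μ * ε^2)) (Set.Icc (3/4*e) e) := by
        apply hrc.comp (f := fun ε => μ * ε^2) (by fun_prop)
        intro x hx
        exact abs_le.1 (hsm x (by linarith [hx.1]) (by linarith [hx.2]))
      exact ((by fun_prop : ContinuousOn (fun ε : ℝ => L^2 * ε^2) _).add
        (continuousOn_const.mul (this.pow 2))).sub continuousOn_const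
    have := intermediate_value_Icc (by linarith : 3/4*e ≤ e) hcont
    have h0 : (0:ℝ) ∈ Set.Icc (L^2 * (3/4*e)^2 + 3 * (r (μ * (3/4*e) ^ 2)) ^ 2 - 1)
        (L^2 * e^2 + 3 * (r (μ * e ^ 2)) ^ 2 - 1) := by
      constructor
      · have c := hsm (3/4*e) (by linarith) (by linarith)
        have c1 := (ch_r_small r hr _ c).1
        have c2 := abs_le.1 (show |r (μ * (3/4*e) ^ 2)| ≤ 3/40 by linarith)
        nlinarith
      · rw [hL2]; nlinarith [sq_nonneg (r (μ * e ^ 2))]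
    obtain ⟨ε, ⟨h1, h2⟩, h⟩ := this h0
    have hε : 0 < ε := by linarith
    refine ⟨ε, ⟨⟨by linarith, by linarith⟩, hε, (hG ε hε).2 h⟩, ?_⟩
    rintro y ⟨⟨y1, y2⟩, y3, y4⟩
    rw [hG y y3] at y4
    simp only at h
    rcases lt_trichotomy y ε with hh | hh | hh
    · have := hmono y ε y3 hh (by linarith)
      linarith
    · exact hh
    · have := hmono ε y hε hh (by linarith)
      linarith
  · rintro ε ⟨h1, h2⟩ hε h
    rw [hG ε hε] at h
    have c := hsm ε hε (by linarith)
    have c1 := (ch_r_small r hr _ c).1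
    have c2 : r (μ * ε^2)^2 ≤ (3/2)^2 * (μ^2 * ε^4) := by
      have : |r (μ * ε^2)|^2 ≤ (3/2 * |μ * ε^2|)^2 := by gcongr
      rw [mul_pow, sq_abs, sq_abs] at this
      linarith
    have c3 : ε^4 ≤ (3/2*e)^4 := by
      have : ε ≤ 3/2*e := by linarith
      gcongr
    have c4 : μ^2 * ε^4 ≤ μ^2 * (3/2*e)^4 := by gcongr
    have k : (e - ε) * (e + ε) = e^2 * (3 * r (μ * ε^2)^2) := by
      linear_combination (ε^2) * hL2 - e^2 * h
    have k0 : 0 ≤ e - ε := by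
      by_contra hn
      have : (e - ε) * (e + ε) < 0 := mul_neg_of_neg_of_pos (by linarith) (by linarith)
      have : 0 ≤ e^2 * (3 * r (μ * ε^2)^2) := by positivity
      linarith
    rw [abs_sub_comm, abs_of_nonneg k0]
    have k1 : (e - ε) * e ≤ e^2 * (40 * (μ^2 * e^4)) := by
      calc (e - ε) * e ≤ (e - ε) * (e + ε) := by gcongr; linarith
        _ = _ := k
        _ ≤ _ := by
          refine mul_le_mul_of_nonneg_left ?_ (sq_nonneg e)
          have : 0 ≤ μ^2 * e^4 := by positivity
          linarith
    have : (e - ε) * e ≤ (40 * e^5 * μ^2) * e := by linarith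
    exact le_of_mul_le_mul_right this he

/-- With r(c) the middle root of x³ − x = c and λₙ = π/2 + nπ,
εₙ⁰ = 1/λₙ, the equation Hₙ(μ,ε) = λₙ² − 1/ε² + 3·r(με²)²/ε² = 0 has, for each small μ,
a unique solution ε near εₙ⁰, and it satisfies |ε − εₙ⁰| ≤ C·μ². -/
theorem cahn_hilliard_bifurcation_point_location (n : ℕ) (r : ℝ → ℝ)
    (hr : ∀ c : ℝ, |c| < 2 / (3 * Real.sqrt 3) →
      r c ∈ Set.Ioo (-(1 / Real.sqrt 3)) (1 / Real.sqrt 3) ∧ (r c) ^ 3 - r c = c) :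
    ∃ μbar > (0 : ℝ), ∃ ρ > (0 : ℝ), ∃ C > (0 : ℝ), ∀ μ : ℝ, |μ| < μbar →
      (∃! ε : ℝ, ε ∈ Set.Ioo (1 / (Real.pi / 2 + n * Real.pi) - ρ)
            (1 / (Real.pi / 2 + n * Real.pi) + ρ) ∧ 0 < ε ∧
          (Real.pi / 2 + n * Real.pi) ^ 2 - 1 / ε ^ 2 + 3 * (r (μ * ε ^ 2)) ^ 2 / ε ^ 2 = 0) ∧
      ∀ ε : ℝ, ε ∈ Set.Ioo (1 / (Real.pi / 2 + n * Real.pi) - ρ)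
            (1 / (Real.pi / 2 + n * Real.pi) + ρ) → 0 < ε →
          (Real.pi / 2 + n * Real.pi) ^ 2 - 1 / ε ^ 2 + 3 * (r (μ * ε ^ 2)) ^ 2 / ε ^ 2 = 0 →
          |ε - 1 / (Real.pi / 2 + n * Real.pi)| ≤ C * μ ^ 2 := by
  have hL : 0 < Real.pi / 2 + n * Real.pi := by positivity
  exact ch_aux (Real.pi / 2 + n * Real.pi) (1 / (Real.pi / 2 + n * Real.pi)) (by positivity) hL
    (by field_simp) r hr
end

section
/- Let n be a nonnegative integer and set λ = π/2 + nπ. Then for every x ∈ [-1,1], ∫_{-1}^{1} |x−y|·sin(λy) dy = −(2/λ²)·sin(λx). -/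
theorem kernel_aux (L x a b : ℝ) (hL : L ≠ 0) :
    ∫ y in a..b, (x - y) * Real.sin (L * y)
      = (-(x - b) * Real.cos (L * b) / L - Real.sin (L * b) / L ^ 2)
        - (-(x - a) * Real.cos (L * a) / L - Real.sin (L * a) / L ^ 2) := by
  apply intervalIntegral.integral_eq_sub_of_hasDerivAt
    (f := fun y => -(x - y) * Real.cos (L * y) / L - Real.sin (L * y) / L ^ 2)
  · intro y _
    have h0 : HasDerivAt (fun y : ℝ => L * y) L y := by
      simpa using (hasDerivAt_id y).const_mul L
    have h1 : HasDerivAt (fun y : ℝ => -(x - y)) 1 y := by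
      simpa using (hasDerivAt_id' y).sub_const x
    have h2 := ((h1.mul h0.cos).div_const L).sub (h0.sin.div_const (L ^ 2))
    refine HasDerivAt.congr_deriv (f := fun y => -(x - y) * Real.cos (L * y) / L - Real.sin (L * y) / L ^ 2) h2 ?_
    field_simp
    ring
  · exact Continuous.intervalIntegrable (by fun_prop) _ _

/-- For a nonnegative integer n and λ = π/2 + nπ,
∫_{-1}^{1} |x−y|·sin(λy) dy = −(2/λ²)·sin(λx) for every x ∈ [-1,1]. -/
theorem kernel_integral_sine_mode (n : ℕ) (x : ℝ) (hx : x ∈ Set.Icc (-1 : ℝ) 1) :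
    ∫ y in (-1 : ℝ)..1, |x - y| * Real.sin ((Real.pi / 2 + n * Real.pi) * y)
      = -(2 / (Real.pi / 2 + n * Real.pi) ^ 2)
          * Real.sin ((Real.pi / 2 + n * Real.pi) * x) := by
  have hL : Real.pi / 2 + n * Real.pi ≠ 0 := by positivity
  have hc : Real.cos (Real.pi / 2 + n * Real.pi) = 0 := by
    rw [Real.cos_add_nat_mul_pi]; simp
  generalize Real.pi / 2 + n * Real.pi = L at hL hc
  obtain ⟨h1, h2⟩ := hx
  have e1 : ∫ y in (-1 : ℝ)..x, |x - y| * Real.sin (L * y)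
      = ∫ y in (-1 : ℝ)..x, (x - y) * Real.sin (L * y) := by
    apply intervalIntegral.integral_congr
    intro y hy
    rw [Set.uIcc_of_le h1] at hy
    simp only
    rw [abs_of_nonneg (by linarith [hy.2])]
  have e2 : ∫ y in x..1, |x - y| * Real.sin (L * y)
      = ∫ y in x..1, -((x - y) * Real.sin (L * y)) := by
    apply intervalIntegral.integral_congr
    intro y hy
    rw [Set.uIcc_of_le h2] at hy
    simp only
    rw [abs_of_nonpos (by linarith [hy.1])]
    ring
  rw [← intervalIntegral.integral_add_adjacent_intervals (b := x)
    (Continuous.intervalIntegrable (by fun_prop) _ _)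
    (Continuous.intervalIntegrable (by fun_prop) _ _), e1, e2,
    intervalIntegral.integral_neg, kernel_aux L x _ _ hL, kernel_aux L x _ _ hL]
  simp only [mul_neg, mul_one, Real.cos_neg, Real.sin_neg, hc]
  ring
end

section
/- Fix a nonnegative integer n, set λₙ = π/2 + nπ, and let ε > 0 be sufficiently small. Set γₙ = −ε·λₙ⁴ + (18/ε)·λₙ². Then there exist δ > 0, a continuous function γ : (−δ,δ) → ℝ with γ(0) = γₙ, a function η : (−δ,δ) → [0,∞) with η(s) → 0 as s → 0, and for each s ∈ (−δ,δ) twice continuously differentiable functions φₛ, uₛ : [-1,1] → ℝ such that: (i) ε·φₛ''(x) − (1/ε)·W'(φₛ(x)) − γ(s)·uₛ(x) = 0 for all x ∈ (−1,1), where W'(t) = 36(2t³ − 3t² + t); (ii) −uₛ''(x) = φₛ(x) − (1/2)∫_{-1}^{1} φₛ(y) dy for all x ∈ (−1,1); (iii) φₛ'(±1) = 0, uₛ'(±1) = 0, and ∫_{-1}^{1} uₛ(x) dx = 0; and (iv) sup_{x ∈ [-1,1]} |φₛ(x) − 1/2 − s·sin(λₙ x)| ≤ η(s)·|s|. -/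
/-! l1 toolkit -/
namespace ACOK

set_option linter.unusedSectionVars false

abbrev A := lp (fun _ : ℕ => ℝ) 1

noncomputable def S (i : ℕ) : A := lp.single 1 i (1 : ℝ)

lemma S_apply (i j : ℕ) : (S i : A) j = if j = i then 1 else 0 := by
  simp [S, Pi.single_apply]

lemma S_norm (i : ℕ) : ‖S i‖ = 1 := by
  simp [S, lp.norm_single]

lemma A_hasSum (a : A) : HasSum (fun i => ‖a i‖) ‖a‖ := by
  simpa using lp.hasSum_norm (p := 1) (by simp) a

noncomputable def coord (i : ℕ) : A →L[ℝ] ℝ :=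
  LinearMap.mkContinuous
    { toFun := fun a => a i, map_add' := fun _ _ => rfl, map_smul' := fun _ _ => rfl } 1
    (fun a => by
      rw [one_mul]
      exact lp.norm_apply_le_norm (p := 1) (by simp) a i)

@[simp] lemma coord_apply (i : ℕ) (a : A) : coord i a = a i := rfl

section lift
variable {E : Type*} [NormedAddCommGroup E] [NormedSpace ℝ E] [CompleteSpace E]

lemma lift_summable_norm (e : ℕ → E) (B : ℝ) (h : ∀ i, ‖e i‖ ≤ B) (a : A) :
    Summable (fun i => ‖a i • e i‖) := by
  refine Summable.of_nonneg_of_le (fun _ => norm_nonneg _) (fun i => ?_)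
    ((A_hasSum a).summable.mul_right B)
  rw [norm_smul]
  exact mul_le_mul_of_nonneg_left (h i) (norm_nonneg _)

lemma lift_summable (e : ℕ → E) (B : ℝ) (h : ∀ i, ‖e i‖ ≤ B) (a : A) :
    Summable (fun i => a i • e i) := (lift_summable_norm e B h a).of_norm

lemma lift_norm (e : ℕ → E) (B : ℝ) (h : ∀ i, ‖e i‖ ≤ B) (a : A) :
    ‖∑' i, a i • e i‖ ≤ B * ‖a‖ := by
  have h1 := (A_hasSum a).mul_right B
  rw [mul_comm] at h1
  refine tsum_of_norm_bounded h1 (fun i => ?_)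
  rw [norm_smul]
  exact mul_le_mul_of_nonneg_left (h i) (norm_nonneg _)

noncomputable def lift (e : ℕ → E) (B : ℝ) (h : ∀ i, ‖e i‖ ≤ B) : A →L[ℝ] E :=
  LinearMap.mkContinuous
    { toFun := fun a => ∑' i, a i • e i
      map_add' := fun a b => by
        rw [← (lift_summable e B h a).tsum_add (lift_summable e B h b)]
        simp [add_smul]
      map_smul' := fun c a => by
        rw [RingHom.id_apply, ← (lift_summable e B h a).tsum_const_smul c]
        simp [mul_smul] } B (lift_norm e B h)

lemma lift_apply (e : ℕ → E) (B : ℝ) (h : ∀ i, ‖e i‖ ≤ B) (a : A) :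
    lift e B h a = ∑' i, a i • e i := rfl

@[simp] lemma lift_S (e : ℕ → E) (B : ℝ) (h : ∀ i, ‖e i‖ ≤ B) (i : ℕ) :
    lift e B h (S i) = e i := by
  rw [lift_apply, tsum_eq_single i]
  · simp [S_apply]
  · intro j hj; simp [S_apply, hj]

lemma lift_opNorm (e : ℕ → E) (B : ℝ) (h : ∀ i, ‖e i‖ ≤ B) : ‖lift e B h‖ ≤ B := by
  refine LinearMap.mkContinuous_norm_le _ ((norm_nonneg _).trans (h 0)) _

lemma A_ext {f g : A →L[ℝ] E} (h : ∀ i, f (S i) = g (S i)) : f = g := by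
  refine lp.ext_continuousLinearMap (p := 1) (by simp) (fun i => ?_)
  ext
  simpa [S] using h i

end lift

/-- diagonal operator -/
noncomputable def diag (d : ℕ → ℝ) (B : ℝ) (h : ∀ i, |d i| ≤ B) : A →L[ℝ] A :=
  lift (fun i => d i • S i) B (fun i => by rw [norm_smul, S_norm]; simpa using h i)

@[simp] lemma diag_apply (d : ℕ → ℝ) (B : ℝ) (h : ∀ i, |d i| ≤ B) (a : A) (j : ℕ) :
    (diag d B h a) j = d j * a j := by
  have : (coord j).comp (diag d B h) = d j • coord j := by
    apply A_ext
    intro i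
    simp only [ContinuousLinearMap.comp_apply, diag, lift_S, map_smul,
      coord_apply, S_apply, smul_apply]
    split_ifs with hh
    · subst hh; rfl
    · simp
  exact congrArg (fun f => f a) this

noncomputable def Ez : ℤ → A
  | Int.ofNat n => S n
  | Int.negSucc n => - S n

lemma Ez_norm (m : ℤ) : ‖Ez m‖ = 1 := by
  cases m <;> simp [Ez, S_norm]

noncomputable def e3 (i j k : ℕ) : A :=
  (1/4 : ℝ) • (Ez (i+j-k) + Ez (i-j+k) + Ez (-i+j+k) - Ez (i+j+k+1))

lemma e3_norm (i j k : ℕ) : ‖e3 i j k‖ ≤ 1 := by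
  rw [e3, norm_smul]
  have := norm_sub_le (Ez (i+j-k) + Ez (i-j+k) + Ez (-i+j+k)) (Ez (i+j+k+1))
  have h2 := norm_add₃_le (a := Ez (i+j-k)) (b := Ez (i-j+k)) (c := Ez (-i+j+k))
  simp only [Ez_norm] at *
  norm_num
  linarith

noncomputable def T : A →L[ℝ] A →L[ℝ] A →L[ℝ] A :=
  lift (fun i => lift (fun j => lift (fun k => e3 i j k) 1 (e3_norm i j)) 1
    (fun _ => lift_opNorm _ _ _)) 1 (fun _ => lift_opNorm _ _ _)

@[simp] lemma T_S (i j k : ℕ) : T (S i) (S j) (S k) = e3 i j k := by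
  simp [T]

/-- evaluation of the sine series -/
noncomputable def Phi (l x : ℝ) : A →L[ℝ] ℝ :=
  lift (fun i => Real.sin ((2*i+1) * l * x)) 1 (fun i => by
    simpa using Real.abs_sin_le_one _)

lemma Phi_apply (l x : ℝ) (a : A) : Phi l x a = ∑' i, a i * Real.sin ((2*i+1) * l * x) := rfl

lemma Phi_S (l x : ℝ) (i : ℕ) : Phi l x (S i) = Real.sin ((2*i+1) * l * x) := by
  simp [Phi]

lemma Phi_Ez (l x : ℝ) (m : ℤ) : Phi l x (Ez m) = Real.sin ((2*m+1) * l * x) := by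
  cases m with
  | ofNat n => simp [Ez, Phi_S]
  | negSucc n =>
    simp only [Ez, map_neg, Phi_S, ← Real.sin_neg]
    congr 1
    push_cast [Int.negSucc_eq]
    ring

lemma Phi_le (l x : ℝ) (a : A) : |Phi l x a| ≤ ‖a‖ := by
  have := (Phi l x).le_of_opNorm_le (lift_opNorm _ 1 _) a
  simpa using this

lemma sin3 (a b c : ℝ) : Real.sin a * Real.sin b * Real.sin c =
    1/4 * (Real.sin (a+b-c) + Real.sin (a-b+c) + Real.sin (-a+b+c) - Real.sin (a+b+c)) := by
  simp only [Real.sin_add, Real.sin_sub, Real.cos_add, Real.cos_sub, Real.sin_neg, Real.cos_neg]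
  ring

lemma Phi_T_S (l x : ℝ) (i j k : ℕ) :
    Phi l x (e3 i j k) = Phi l x (S i) * Phi l x (S j) * Phi l x (S k) := by
  rw [Phi_S, Phi_S, Phi_S, sin3, e3]
  simp only [map_smul, map_add, map_sub, Phi_Ez, smul_eq_mul]
  push_cast
  congr 4 <;> (try congr 1) <;> ring_nf

lemma Phi_T (l x : ℝ) (a b c : A) :
    Phi l x (T a b c) = Phi l x a * Phi l x b * Phi l x c := by
  have h1 : ∀ i j, (Phi l x).comp (T (S i) (S j)) =
      (Phi l x (S i) * Phi l x (S j)) • Phi l x := by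
    intro i j
    apply A_ext
    intro k
    simp [Phi_T_S]
  have h2 : ∀ i c, (Phi l x).comp ((T (S i)).flip c) =
      (Phi l x (S i) * Phi l x c) • Phi l x := by
    intro i c
    apply A_ext
    intro j
    have := congrArg (fun f => f c) (h1 i j)
    simp at this ⊢
    rw [this]; ring
  have h3 : (Phi l x).comp ((T.flip b).flip c) =
      (Phi l x b * Phi l x c) • Phi l x := by
    apply A_ext
    intro i
    have := congrArg (fun f => f b) (h2 i c)
    simp at this ⊢
    rw [this]; ring
  have := congrArg (fun f => f a) h3
  simp at this ⊢
  rw [this]; ring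

end ACOK

namespace ACOK

noncomputable def mu (l : ℝ) (j : ℕ) : ℝ := ((2*j+1) * l)^2

lemma mu_pos {l : ℝ} (hl : 0 < l) (j : ℕ) : 0 < mu l j := by unfold mu; positivity

lemma mu_le {l : ℝ} (hl : 0 < l) (j : ℕ) : l^2 ≤ mu l j := by
  unfold mu
  have : l ≤ (2*j+1) * l := by nlinarith [(Nat.cast_nonneg j : (0:ℝ) ≤ j)]
  exact pow_le_pow_left₀ hl.le this 2

lemma mu_inv_le {l : ℝ} (hl : 0 < l) (j : ℕ) : |(mu l j)⁻¹| ≤ (l^2)⁻¹ := by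
  rw [abs_of_pos (inv_pos.2 (mu_pos hl j))]
  exact inv_anti₀ (by positivity) (mu_le hl j)

noncomputable def Mop (l : ℝ) (hl : 0 < l) : A →L[ℝ] A :=
  diag (fun j => (mu l j)⁻¹) (l^2)⁻¹ (mu_inv_le hl)

lemma Mop_apply (l : ℝ) (hl : 0 < l) (a : A) (j : ℕ) : Mop l hl a j = (mu l j)⁻¹ * a j := by
  simp [Mop]

lemma Phi_continuous (l : ℝ) (a : A) : Continuous (fun x => Phi l x a) := by
  simp only [Phi_apply]
  refine continuous_tsum (u := fun i => ‖a i‖) (fun i => by fun_prop) (A_hasSum a).summable ?_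
  intro i x
  rw [norm_mul]
  exact mul_le_of_le_one_right (norm_nonneg _) (Real.abs_sin_le_one _)

noncomputable def Psi (l x : ℝ) (b : A) : ℝ :=
  ∑' i, b i * (((2*i+1) * l)⁻¹ * Real.cos ((2*i+1) * l * x))

lemma pl_inv_le {l : ℝ} (hl : 0 < l) (i : ℕ) : |((2*i+1) * l)⁻¹| ≤ l⁻¹ := by
  rw [abs_of_pos (by positivity)]
  exact inv_anti₀ hl (by nlinarith [(Nat.cast_nonneg i : (0:ℝ) ≤ i)])

lemma Phi_hasDerivAt (l : ℝ) (hl : 0 < l) (b : A) (x : ℝ) :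
    HasDerivAt (fun x => Phi l x (Mop l hl b)) (Psi l x b) x := by
  simp only [Phi_apply, Psi]
  refine hasDerivAt_tsum (𝕜 := ℝ) (F := ℝ)
    (g := fun i x => Mop l hl b i * Real.sin ((2*i+1) * l * x))
    (g' := fun i x => b i * (((2*i+1) * l)⁻¹ * Real.cos ((2*i+1) * l * x))) (u := fun i => ‖b i‖ * l⁻¹) ((A_hasSum b).summable.mul_right _)
    (fun i y => ?_) (fun i y => ?_) (y₀ := 0) ?_ x
  · have h1 : HasDerivAt (fun y : ℝ => (2*(i:ℝ)+1) * l * y) ((2*(i:ℝ)+1) * l * 1) y :=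
      (hasDerivAt_id y).const_mul _
    have h2 := (h1.sin).const_mul (Mop l hl b i)
    convert! h2 using 1
    rw [Mop_apply, mu]
    have : (2*(i:ℝ)+1) ≠ 0 := by positivity
    field_simp
  · rw [norm_mul, norm_mul]
    refine mul_le_mul_of_nonneg_left ?_ (norm_nonneg _)
    have h1 := pl_inv_le hl i
    have h2 := Real.abs_cos_le_one ((2*i+1) * l * y)
    simp only [Real.norm_eq_abs]
    exact (mul_le_of_le_one_right (abs_nonneg _) h2).trans h1
  · simp [summable_zero]

lemma Psi_hasDerivAt (l : ℝ) (hl : 0 < l) (b : A) (x : ℝ) :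
    HasDerivAt (fun x => Psi l x b) (- Phi l x b) x := by
  simp only [Phi_apply, Psi, ← tsum_neg]
  refine hasDerivAt_tsum (𝕜 := ℝ) (F := ℝ)
    (g := fun i x => b i * (((2*i+1) * l)⁻¹ * Real.cos ((2*i+1) * l * x)))
    (g' := fun i x => -(b i * Real.sin ((2*i+1) * l * x))) (u := fun i => ‖b i‖) ((A_hasSum b).summable)
    (fun i y => ?_) (fun i y => ?_) (y₀ := 0) ?_ x
  · have h1 : HasDerivAt (fun y : ℝ => (2*(i:ℝ)+1) * l * y) ((2*(i:ℝ)+1) * l * 1) y :=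
      (hasDerivAt_id y).const_mul _
    have h2 := ((h1.cos).const_mul (((2*i+1) * l)⁻¹)).const_mul (b i)
    convert! h2 using 1
    have : (2*(i:ℝ)+1) ≠ 0 := by positivity
    field_simp
  · rw [norm_neg, norm_mul]
    exact mul_le_of_le_one_right (norm_nonneg _) (Real.abs_sin_le_one _)
  · refine Summable.of_norm_bounded ((A_hasSum b).summable.mul_right l⁻¹) (fun i => ?_)
    rw [norm_mul]
    refine mul_le_mul_of_nonneg_left ?_ (norm_nonneg _)
    simpa [-mul_inv_rev] using pl_inv_le hl i

lemma Phi_deriv (l : ℝ) (hl : 0 < l) (b : A) :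
    deriv (fun x => Phi l x (Mop l hl b)) = fun x => Psi l x b :=
  funext fun x => (Phi_hasDerivAt l hl b x).deriv

lemma Psi_deriv (l : ℝ) (hl : 0 < l) (b : A) :
    deriv (fun x => Psi l x b) = fun x => - Phi l x b :=
  funext fun x => (Psi_hasDerivAt l hl b x).deriv

lemma Phi_contDiff (l : ℝ) (hl : 0 < l) (b : A) :
    ContDiff ℝ 2 (fun x => Phi l x (Mop l hl b)) := by
  have h1 : ContDiff ℝ 1 (fun x => Psi l x b) := by
    rw [contDiff_one_iff_deriv, Psi_deriv l hl]
    exact ⟨fun x => (Psi_hasDerivAt l hl b x).differentiableAt, (Phi_continuous l b).neg⟩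
  rw [show (2 : WithTop ℕ∞) = 1 + 1 by norm_num, contDiff_succ_iff_deriv, Phi_deriv l hl]
  exact ⟨fun x => (Phi_hasDerivAt l hl b x).differentiableAt, by simp, h1⟩

lemma Phi_odd (l x : ℝ) (a : A) : Phi l (-x) a = - Phi l x a := by
  simp only [Phi_apply, ← tsum_neg]
  congr 1; ext i
  rw [mul_neg, Real.sin_neg]; ring

lemma Phi_integral (l : ℝ) (a : A) : ∫ x in (-1:ℝ)..1, Phi l x a = 0 := by
  have h := intervalIntegral.integral_comp_neg (a := -1) (b := 1) (fun x => Phi l x a)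
  simp only [Phi_odd, neg_neg, intervalIntegral.integral_neg] at h
  linarith

lemma Psi_zero (n : ℕ) (b : A) (x : ℝ) (hx : x = 1 ∨ x = -1) :
    Psi (Real.pi / 2 + n * Real.pi) x b = 0 := by
  have key : ∀ i : ℕ, Real.cos ((2*i+1) * (Real.pi / 2 + n * Real.pi) * 1) = 0 := by
    intro i
    rw [Real.cos_eq_zero_iff]
    exact ⟨2*i*n + i + n, by push_cast; ring⟩
  have : ∀ i : ℕ, Real.cos ((2*i+1) * (Real.pi / 2 + n * Real.pi) * x) = 0 := by
    intro i
    rcases hx with rfl | rfl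
    · exact key i
    · rw [mul_neg, Real.cos_neg]; exact key i
  simp [Psi, this]

end ACOK

namespace ACOK
open Filter Topology

lemma rankone_invertible (f : A →L[ℝ] ℝ) (v : A) (h : 1 + f v ≠ 0) :
    (ContinuousLinearMap.id ℝ A + f.smulRight v).IsInvertible := by
  refine ContinuousLinearMap.IsInvertible.of_inverse
    (g := ContinuousLinearMap.id ℝ A - (1 + f v)⁻¹ • f.smulRight v) ?_ ?_
  · ext1 y
    simp only [ContinuousLinearMap.comp_apply, add_apply, sub_apply, smul_apply,
      ContinuousLinearMap.smulRight_apply, ContinuousLinearMap.id_apply, map_sub, map_smul,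
      smul_eq_mul]
    match_scalars
    · ring
    · field_simp
      ring
  · ext1 y
    simp only [ContinuousLinearMap.comp_apply, add_apply, sub_apply, smul_apply,
      ContinuousLinearMap.smulRight_apply, ContinuousLinearMap.id_apply, map_add, map_smul,
      smul_eq_mul]
    match_scalars
    · ring
    · field_simp
      ring

noncomputable def N (a : A) : A := T a a a

noncomputable def hh (l C : ℝ) (a : A) : ℝ := -(l^2 * C) * coord 0 (N a)

noncomputable def Z (l : ℝ) (hl : 0 < l) (C : ℝ) (a : A) : A :=
  hh l C a • Mop l hl a + C • N a

lemma N_contDiff : ContDiff ℝ 1 N := by unfold N; fun_prop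

lemma hh_contDiff (l C : ℝ) : ContDiff ℝ 1 (hh l C) := by
  have := N_contDiff
  unfold hh; fun_prop

lemma Z_contDiff (l : ℝ) (hl : 0 < l) (C : ℝ) : ContDiff ℝ 1 (Z l hl C) := by
  have := N_contDiff
  have := hh_contDiff l C
  unfold Z; fun_prop

noncomputable def DN (a : A) : A →L[ℝ] A := fderiv ℝ N a

lemma N_hasFDerivAt (a : A) : HasFDerivAt N (DN a) a :=
  ((N_contDiff.differentiable (by norm_num)) a).hasFDerivAt

lemma DN_apply (a y : A) : DN a y = T y a a + T a y a + T a a y := by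
  have h := ((T.hasFDerivAt (x := a)).clm_apply (hasFDerivAt_id a)).clm_apply (hasFDerivAt_id a)
  have h2 := (N_hasFDerivAt a).unique h
  rw [h2]
  simp
  abel

lemma Ez_nat (n : ℕ) : Ez (n : ℤ) = S n := rfl

lemma N_S0 : N (S 0) = (3/4 : ℝ) • S 0 - (1/4 : ℝ) • S 1 := by
  rw [N, T_S, e3]
  have h0 : Ez 0 = S 0 := rfl
  have h1 : Ez 1 = S 1 := rfl
  simp [h0, h1]
  module

lemma DN_Sk (k : ℕ) (hk : 2 ≤ k) : (DN (S 0) (S k)) k = 3/2 := by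
  obtain ⟨k, rfl⟩ := Nat.exists_eq_add_of_le' hk
  rw [DN_apply, T_S, T_S, T_S, e3, e3, e3]
  have h0 : Ez (((k+2 : ℕ) : ℤ)) = S (k+2) := rfl
  have h1 : Ez (((k+2 : ℕ) : ℤ) + 1) = S (k+3) := rfl
  have h2 : Ez (-((k+2 : ℕ) : ℤ)) = - S (k+1) := rfl
  simp only [Nat.cast_zero, add_zero, zero_add, sub_zero, neg_zero, zero_sub, h0, h1, h2]
  have key : ∀ a b c d : A, ((1/4:ℝ) • (a+b+c-d)) (k+2) = 1/4*(a (k+2) + b (k+2) + c (k+2) - d (k+2)) := 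
    fun a b c d => rfl
  have kadd : ∀ a b : A, (a + b) (k+2) = a (k+2) + b (k+2) := fun _ _ => rfl
  have kneg : ∀ a : A, (-a) (k+2) = - a (k+2) := fun _ => rfl
  simp only [kadd, key, kneg, S_apply]
  norm_num

noncomputable def DZ (l : ℝ) (hl : 0 < l) (C : ℝ) : A →L[ℝ] A := fderiv ℝ (Z l hl C) (S 0)

lemma Z_hasFDerivAt (l : ℝ) (hl : 0 < l) (C : ℝ) :
    HasFDerivAt (Z l hl C) (DZ l hl C) (S 0) :=
  (((Z_contDiff l hl C).differentiable (by norm_num)) _).hasFDerivAt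

lemma DZ_Sk (l : ℝ) (hl : 0 < l) (C : ℝ) (k : ℕ) (hk : 2 ≤ k) :
    (DZ l hl C (S k)) k = C * (3/2 - 3/(4*(2*k+1)^2)) := by
  have hN := N_hasFDerivAt (S 0)
  have h1 := (((coord 0).hasFDerivAt (x := N (S 0))).comp (S 0) hN).const_mul (-(l^2*C))
  have h2 := (h1.smul ((Mop l hl).hasFDerivAt (x := S 0))).add (hN.const_smul C)
  have h3 := (Z_hasFDerivAt l hl C).unique h2
  have h4 : coord k (DZ l hl C (S k)) = _ := congrArg (fun f => coord k (f (S k))) h3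
  rw [coord_apply] at h4
  rw [h4]
  simp only [add_apply, smul_apply, ContinuousLinearMap.comp_apply,
    ContinuousLinearMap.smulRight_apply, map_add, map_smul, smul_eq_mul, Function.comp_apply, N_S0, map_sub, coord_apply, DN_Sk k hk, Mop_apply, S_apply, mu]
  have : k ≠ 0 := by omega
  simp [this]
  field_simp
  ring

noncomputable def F (l : ℝ) (hl : 0 < l) (C : ℝ) (Q : A →L[ℝ] A) (r : ℝ) (k : ℕ) (p : ℝ × A) : A :=
  p.2 - S 0 - p.1 • Q (Z l hl C p.2) + (r * (coord k (Z l hl C p.2) - coord k p.2)) • S k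

lemma F_contDiff (l : ℝ) (hl : 0 < l) (C : ℝ) (Q : A →L[ℝ] A) (r : ℝ) (k : ℕ) :
    ContDiff ℝ 1 (F l hl C Q r k) := by
  have := Z_contDiff l hl C
  unfold F; fun_prop

lemma F_zero (l : ℝ) (hl : 0 < l) (C : ℝ) (Q : A →L[ℝ] A) (r : ℝ) (k : ℕ) (hk : 2 ≤ k) :
    F l hl C Q r k (0, S 0) = 0 := by
  have h0 : k ≠ 0 := by omega
  have h1 : k ≠ 1 := by omega
  simp [F, Z, N_S0, Mop_apply, S_apply, h0, h1, -coord_apply]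
  simp [Mop_apply, S_apply, h0, h1]

lemma exists_branch (l : ℝ) (hl : 0 < l) (C : ℝ) (hC : 0 < C) (Q : A →L[ℝ] A) (r : ℝ)
    (hr : r = 0 ∨ r = 1) (k : ℕ) (hk : 2 ≤ k) :
    ∃ ψ : ℝ → A, ψ 0 = S 0 ∧ ∃ δ > (0:ℝ), ContinuousOn ψ (Set.Ioo (-δ) δ) ∧
      ∀ t ∈ Set.Ioo (-δ) δ, F l hl C Q r k (t, ψ t) = 0 := by
  have hstrict := (F_contDiff l hl C Q r k).contDiffAt.hasStrictFDerivAt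
    (x := ((0:ℝ), S 0)) (by norm_num)
  set f' := fderiv ℝ (F l hl C Q r k) (0, S 0)
  set ℓ : A →L[ℝ] ℝ := r • ((coord k).comp (DZ l hl C) - coord k) with hℓ
  have hJ : f' ∘L .inr ℝ ℝ A = ContinuousLinearMap.id ℝ A + ℓ.smulRight (S k) := by
    have h1 : HasFDerivAt (fun a : A => F l hl C Q r k (0, a)) (f' ∘L .inr ℝ ℝ A) (S 0) :=
      HasFDerivAt.comp (g := F l hl C Q r k) (f := fun a : A => ((0:ℝ), a)) (S 0)
        hstrict.hasFDerivAt (hasFDerivAt_prodMk_right 0 (S 0))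
    have hZ := Z_hasFDerivAt l hl C
    have h2 : HasFDerivAt (fun a : A => F l hl C Q r k (0, a))
      (ContinuousLinearMap.id ℝ A + ℓ.smulRight (S k)) (S 0) := by
      have h3 := ((((coord k).hasFDerivAt (x := Z l hl C (S 0))).comp (S 0) hZ).sub
        ((coord k).hasFDerivAt (x := S 0))).const_mul r
      have h4 := ((hasFDerivAt_id (𝕜 := ℝ) (S 0)).sub_const (S 0)).add (h3.smul_const (S k))
      refine h4.congr_of_eventuallyEq (Eventually.of_forall fun a => ?_)
      simp [F]
    exact h1.unique h2
  have hinv : (f' ∘L .inr ℝ ℝ A).IsInvertible := by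
    rw [hJ]
    apply rankone_invertible
    have : ℓ (S k) = r * (C * (3/2 - 3/(4*(2*k+1)^2)) - 1) := by
      simp [hℓ, DZ_Sk l hl C k hk, S_apply]
    rw [this]
    rcases hr with rfl | rfl
    · norm_num
    · have hk' : (2:ℝ) ≤ k := by exact_mod_cast hk
      have : 3/(4*(2*(k:ℝ)+1)^2) < 3/2 := by
        rw [div_lt_div_iff₀ (by positivity) (by norm_num)]
        nlinarith
      have : 0 < C * (3/2 - 3/(4*(2*(k:ℝ)+1)^2)) := mul_pos hC (by linarith)
      ring_nf at this ⊢
      exact this.ne'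
  set ψ := hstrict.implicitFunctionOfProdDomain hinv
  have hψ0 : ψ 0 = S 0 :=
    (hstrict.eventually_apply_eq_iff_implicitFunctionOfProdDomain hinv).self_of_nhds.mp rfl
  have hev := hstrict.eventually_apply_implicitFunctionOfProdDomain hinv
  obtain ⟨K, s, hs, hlip⟩ :=
    (hstrict.hasStrictFDerivAt_implicitFunctionOfProdDomain hinv).exists_lipschitzOnWith
  rw [F_zero l hl C Q r k hk] at hev
  obtain ⟨δ, hδ, hball⟩ := Metric.eventually_nhds_iff_ball.1 (hev.and hs)
  refine ⟨ψ, hψ0, δ, hδ, ?_, ?_⟩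
  · refine hlip.continuousOn.mono fun t ht => (hball t ?_).2
    simpa [Real.ball_eq_Ioo] using ht
  · intro t ht
    exact (hball t (by simpa [Real.ball_eq_Ioo] using ht)).1

end ACOK

namespace ACOK
open Filter Topology

noncomputable def gam (l ε : ℝ) : ℝ := -ε * l^4 + (18/ε) * l^2

noncomputable def mm (l ε : ℝ) (j : ℕ) : ℝ := -ε * mu l j + 18/ε - gam l ε * (mu l j)⁻¹

lemma mm_factor (l ε : ℝ) (hl : 0 < l) (hε : 0 < ε) (j : ℕ) :
    mm l ε j = ε * (mu l j)⁻¹ * (mu l j - l^2) * (18/ε^2 - l^2 - mu l j) := by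
  have := mu_pos hl j
  unfold mm gam
  field_simp
  ring

lemma mu_tendsto (l : ℝ) (hl : 0 < l) : Tendsto (mu l) atTop atTop := by
  unfold mu
  refine (tendsto_pow_atTop (by norm_num)).comp (Tendsto.atTop_mul_const hl ?_)
  refine tendsto_atTop_add_const_right _ _ ?_
  exact Tendsto.const_mul_atTop (by norm_num) tendsto_natCast_atTop_atTop

lemma Q_bound (l ε : ℝ) (hl : 0 < l) (hε : 0 < ε) :
    ∃ B, ∀ j, |mu l j * (mm l ε j)⁻¹| ≤ B := by
  have hi : Tendsto (fun j => (mu l j)⁻¹) atTop (𝓝 0) := (mu_tendsto l hl).inv_tendsto_atTop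
  have h1 : Tendsto (fun j => -ε + 18/ε * (mu l j)⁻¹ - gam l ε * ((mu l j)⁻¹ * (mu l j)⁻¹))
      atTop (𝓝 (-ε + 18/ε * 0 - gam l ε * (0*0))) :=
    ((hi.const_mul _).const_add _).sub ((hi.mul hi).const_mul _)
  have h2 := (h1.inv₀ (by simp [hε.ne'])).abs
  obtain ⟨B, hB⟩ := h2.bddAbove_range
  refine ⟨B, fun j => ?_⟩
  refine le_trans (le_of_eq ?_) (hB ⟨j, rfl⟩)
  have := mu_pos hl j
  congr 1
  rw [← inv_inv (mu l j), ← mul_inv, inv_inv]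
  congr 1
  unfold mm
  field_simp

lemma exists_k (l ε : ℝ) (hl : 0 < l) (hε : 0 < ε) (hsmall : ε < 1 / l) :
    ∃ k : ℕ, 2 ≤ k ∧ ∀ j, j ≠ 0 → j ≠ k → mm l ε j ≠ 0 := by
  have hmm : ∀ j : ℕ, j ≠ 0 → mm l ε j = 0 → mu l j = 18/ε^2 - l^2 := by
    intro j hj h
    rw [mm_factor l ε hl hε] at h
    have h1 := mu_pos hl j
    have h2 : mu l j - l^2 ≠ 0 := by
      have : (1:ℝ) ≤ j := by exact_mod_cast Nat.one_le_iff_ne_zero.2 hj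
      have : mu l j - l^2 = l^2 * (4*j^2+4*j) := by unfold mu; ring
      rw [this]; positivity
    have h3 : ε * (mu l j)⁻¹ * (mu l j - l^2) ≠ 0 := mul_ne_zero (by positivity) h2
    have := (mul_eq_zero.1 h).resolve_left h3
    linarith
  by_cases hex : ∃ k : ℕ, k ≠ 0 ∧ mm l ε k = 0
  · obtain ⟨k, hk0, hk⟩ := hex
    have hk' := hmm k hk0 hk
    refine ⟨k, ?_, ?_⟩
    · by_contra hlt
      have : k = 1 := by omega
      subst this
      have h9 : mu l 1 = 9 * l^2 := by unfold mu; push_cast; ring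
      rw [h9] at hk'
      have h10 : 18/ε^2 = 10 * l^2 := by linarith
      rw [div_eq_iff (by positivity)] at h10
      have h11 : ε * l < 1 := by rwa [lt_div_iff₀ hl] at hsmall
      have h12 : 0 < ε * l := by positivity
      nlinarith
    · intro j hj0 hjk hj
      apply hjk
      have h := hmm j hj0 hj
      rw [← hk'] at h
      unfold mu at h
      rw [pow_left_inj₀ (by positivity) (by positivity) (by norm_num)] at h
      have h' := mul_right_cancel₀ hl.ne' h
      have : (j:ℝ) = k := by linarith
      exact_mod_cast this
  · push Not at hex
    exact ⟨2, le_rfl, fun j hj _ => hex j hj⟩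

lemma add_c (a b : A) (j : ℕ) : (a + b) j = a j + b j := rfl
lemma sub_c (a b : A) (j : ℕ) : (a - b) j = a j - b j := rfl
lemma smul_c (c : ℝ) (a : A) (j : ℕ) : (c • a) j = c * a j := rfl

lemma branch (l ε : ℝ) (hl : 0 < l) (hε : 0 < ε) (hsmall : ε < 1 / l) :
    ∃ ψ : ℝ → A, ψ 0 = S 0 ∧ ∃ δ > (0:ℝ), ContinuousOn ψ (Set.Ioo (-δ) δ) ∧
      ∀ t ∈ Set.Ioo (-δ) δ, ∃ b : A, ψ t = Mop l hl b ∧ ∀ x,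
        -ε * Phi l x b + 18/ε * Phi l x (ψ t) - 72/ε * t * (Phi l x (ψ t))^3
          - (gam l ε + t * hh l (72/ε) (ψ t)) * Phi l x (Mop l hl (ψ t)) = 0 := by
  obtain ⟨k, hk, hres⟩ := exists_k l ε hl hε hsmall
  obtain ⟨B, hB⟩ := Q_bound l ε hl hε
  set Q' := diag _ B hB with hQ'
  set Q := (Mop l hl).comp Q' with hQ
  have hQa : ∀ x j, Q x j = (mm l ε j)⁻¹ * x j := by
    intro x j
    have := (mu_pos hl j).ne'
    simp only [hQ, hQ', ContinuousLinearMap.comp_apply, Mop_apply, diag_apply]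
    field_simp
  set r : ℝ := if mm l ε k = 0 then 1 else 0 with hr
  obtain ⟨ψ, h0, δ, hδ, hc, hF⟩ := exists_branch l hl (72/ε) (by positivity) Q r
    (by rw [hr]; split_ifs <;> simp) k hk
  refine ⟨ψ, h0, δ, hδ, hc, fun t ht => ?_⟩
  have hFt := hF t ht
  set a := ψ t
  set z := Z l hl (72/ε) a with hz
  have hFc : ∀ j, a j - (S 0) j - t * ((mm l ε j)⁻¹ * z j) + r * (z k - a k) * (S k) j = 0 := by
    intro j
    have := congrArg (fun y : A => y j) hFt
    simp only [F, add_c, sub_c, smul_c, hQa, coord_apply] at this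
    exact this
  have hmu0 : mu l 0 = l^2 := by unfold mu; simp
  have hm0 : mm l ε 0 = 0 := by
    rw [mm_factor l ε hl hε, hmu0]; ring
  have hk0 : k ≠ 0 := by omega
  have hzc : ∀ j, z j = hh l (72/ε) a * ((mu l j)⁻¹ * a j) + 72/ε * N a j := by
    intro j
    simp only [hz, Z, add_c, smul_c, Mop_apply]
  have ha0 : a 0 = 1 := by
    have := hFc 0
    simp [S_apply, hm0, hk0.symm] at this
    linarith
  have hz0 : z 0 = 0 := by
    rw [hzc, ha0, hmu0, hh, coord_apply]
    field_simp
    ring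
  have hmode : ∀ j, mm l ε j * a j = t * z j := by
    intro j
    by_cases hj0 : j = 0
    · subst hj0; rw [hm0, hz0]; ring
    have h := hFc j
    by_cases hm : mm l ε j = 0
    · have hjk : j = k := by
        by_contra hjk
        exact hres j hj0 hjk hm
      subst hjk
      simp [S_apply, hj0, hm, hr] at h
      rw [hm, h]; ring
    · have hzero : r * (z k - a k) * (S k) j = 0 := by
        by_cases hjk : j = k
        · subst hjk; simp [hr, hm]
        · simp [S_apply, hjk]
      rw [hzero] at h
      simp [S_apply, hj0] at h
      have : a j = t * ((mm l ε j)⁻¹ * z j) := by linarith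
      rw [this]; field_simp
  set b : A := mu l 0 • S 0 + t • Q' z - (mu l k * (r * (z k - a k))) • S k with hb
  have hab : a = Mop l hl b := by
    ext j
    have h := hFc j
    have hmu := (mu_pos hl j).ne'
    rw [Mop_apply, hb]
    simp only [add_c, sub_c, smul_c, hQ', diag_apply]
    have e1 : mu l 0 * (S 0) j = mu l j * (S 0) j := by
      rw [S_apply]; split_ifs with hj
      · rw [hj]
      · simp
    have e2 : mu l k * (r * (z k - a k)) * (S k) j = mu l j * (r * (z k - a k)) * (S k) j := by
      rw [S_apply]; split_ifs with hj
      · rw [hj]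
      · simp
    rw [e1, e2]
    have : (mu l j)⁻¹ * (mu l j * (S 0) j + t * (mu l j * (mm l ε j)⁻¹ * z j)
      - mu l j * (r * (z k - a k)) * (S k) j) =
      (S 0) j + t * ((mm l ε j)⁻¹ * z j) - r * (z k - a k) * (S k) j := by
      rw [inv_mul_eq_iff_eq_mul₀ hmu]; ring
    rw [this]; linarith
  refine ⟨b, hab, fun x => ?_⟩
  have hvec : (-ε) • b + (18/ε) • a - (72/ε*t) • N a - (gam l ε + t * hh l (72/ε) a) • Mop l hl a
      = 0 := by
    ext j
    have h := hmode j
    have hmu := (mu_pos hl j).ne'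
    have hbj : b j = mu l j * a j := by
      rw [hab, Mop_apply]; field_simp
    rw [hzc, mm] at h
    simp only [add_c, sub_c, smul_c, Mop_apply, hbj]
    change _ = (0:ℝ)
    linear_combination h
  have := congrArg (Phi l x) hvec
  simp only [map_add, map_sub, map_smul, map_zero, N, Phi_T, smul_eq_mul] at this
  linear_combination this

end ACOK

/-- For each nonnegative integer n with λₙ = π/2 + nπ and all sufficiently
small ε > 0, setting γₙ = −ελₙ⁴ + (18/ε)λₙ², there is a branch (φₛ, uₛ, γ(s)) of solutions
of the steady Allen–Cahn–Ohta–Kawasaki system bifurcating from the constant state 1/2 at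
γ = γₙ in the direction sin(λₙ x), with remainder o(s). -/
theorem acok_bifurcation_sine_branch (n : ℕ) :
    ∃ ε₀ > (0 : ℝ), ∀ ε : ℝ, 0 < ε → ε < ε₀ →
      ∃ δ > (0 : ℝ), ∃ γ : ℝ → ℝ,
        ContinuousOn γ (Set.Ioo (-δ) δ) ∧
        γ 0 = -ε * (Real.pi / 2 + n * Real.pi) ^ 4
              + (18 / ε) * (Real.pi / 2 + n * Real.pi) ^ 2 ∧
        ∃ η : ℝ → ℝ, (∀ s : ℝ, 0 ≤ η s) ∧
          Filter.Tendsto η (nhds 0) (nhds 0) ∧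
          ∃ φ : ℝ → ℝ → ℝ, ∃ u : ℝ → ℝ → ℝ, ∀ s ∈ Set.Ioo (-δ) δ,
            ContDiff ℝ 2 (φ s) ∧ ContDiff ℝ 2 (u s) ∧
            (∀ x ∈ Set.Ioo (-1 : ℝ) 1,
              ε * deriv (deriv (φ s)) x
                - (1 / ε) * (36 * (2 * (φ s x) ^ 3 - 3 * (φ s x) ^ 2 + φ s x))
                - γ s * u s x = 0) ∧
            (∀ x ∈ Set.Ioo (-1 : ℝ) 1,
              -(deriv (deriv (u s)) x) = φ s x - (1 / 2) * ∫ y in (-1 : ℝ)..1, φ s y) ∧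
            deriv (φ s) (-1) = 0 ∧ deriv (φ s) 1 = 0 ∧
            deriv (u s) (-1) = 0 ∧ deriv (u s) 1 = 0 ∧
            (∫ x in (-1 : ℝ)..1, u s x) = 0 ∧
            (∀ x ∈ Set.Icc (-1 : ℝ) 1,
              |φ s x - 1 / 2 - s * Real.sin ((Real.pi / 2 + n * Real.pi) * x)|
                ≤ η s * |s|) := by
  open ACOK in
  have hl : 0 < Real.pi / 2 + n * Real.pi := by positivity
  have hzero := Psi_zero n
  set l := Real.pi / 2 + n * Real.pi with hldef
  refine ⟨1 / l, by positivity, fun ε hε hsmall => ?_⟩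
  obtain ⟨ψ, h0, δ, hδ, hc, hF⟩ := branch l ε hl hε hsmall
  have hmem : ∀ s ∈ Set.Ioo (-(min 1 δ)) (min 1 δ), s^2 ∈ Set.Ioo (-δ) δ := by
    intro s hs
    have h1 := abs_lt.2 hs
    have h2 : |s| < 1 := h1.trans_le (min_le_left _ _)
    have h3 : |s| < δ := h1.trans_le (min_le_right _ _)
    rw [← sq_abs]
    constructor <;> nlinarith [abs_nonneg s]
  have hc2 : ContinuousOn (fun s : ℝ => ψ (s^2)) (Set.Ioo (-(min 1 δ)) (min 1 δ)) :=
    hc.comp (by fun_prop) hmem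
  refine ⟨min 1 δ, by positivity, fun s => gam l ε + s^2 * hh l (72/ε) (ψ (s^2)), ?_, ?_,
    fun s => ‖ψ (s^2) - S 0‖, fun s => norm_nonneg _, ?_,
    fun s x => 1/2 + s * Phi l x (ψ (s^2)), fun s x => s * Phi l x (Mop l hl (ψ (s^2))), ?_⟩
  · exact continuousOn_const.add ((by fun_prop : ContinuousOn (fun s : ℝ => s^2) _).mul
      ((hh_contDiff l _).continuous.comp_continuousOn hc2))
  · simp [gam]
  · have hat : ContinuousAt (fun s : ℝ => ψ (s^2)) 0 :=
      hc2.continuousAt (Ioo_mem_nhds (by simp [hδ]) (by simp [hδ]))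
    have := (hat.sub (continuousAt_const (y := S 0))).norm.tendsto
    simpa [h0] using this
  · intro s hs
    obtain ⟨b, hab, heq⟩ := hF _ (hmem s hs)
    have dφ : deriv (fun x => 1/2 + s * Phi l x (ψ (s^2))) = fun x => s * Psi l x b := by
      funext x
      rw [hab]
      exact (((Phi_hasDerivAt l hl b x).const_mul s).const_add _).deriv
    have ddφ : ∀ x, deriv (fun x => s * Psi l x b) x = s * (- Phi l x b) := fun x =>
      ((Psi_hasDerivAt l hl b x).const_mul s).deriv
    have du : deriv (fun x => s * Phi l x (Mop l hl (ψ (s^2)))) =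
        fun x => s * Psi l x (ψ (s^2)) := by
      funext x
      exact ((Phi_hasDerivAt l hl _ x).const_mul s).deriv
    have ddu : ∀ x, deriv (fun x => s * Psi l x (ψ (s^2))) x = s * (- Phi l x (ψ (s^2))) :=
      fun x => ((Psi_hasDerivAt l hl _ x).const_mul s).deriv
    have hint : ∫ y in (-1:ℝ)..1, (1/2 + s * Phi l y (ψ (s^2))) = 1 := by
      rw [intervalIntegral.integral_add (by simp)
        (((Phi_continuous l _).const_mul s).intervalIntegrable _ _),
        intervalIntegral.integral_const_mul, Phi_integral]
      norm_num
    refine ⟨?_, ?_, ?_, ?_, ?_, ?_, ?_, ?_, ?_, ?_⟩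
    · beta_reduce
      rw [hab]
      exact contDiff_const.add (contDiff_const.mul (Phi_contDiff l hl b))
    · exact contDiff_const.mul (Phi_contDiff l hl _)
    · intro x _
      beta_reduce
      rw [dφ, ddφ]
      linear_combination s * heq x
    · intro x _
      beta_reduce
      rw [du, ddu, hint]
      ring
    · rw [dφ]; simp [hzero b (-1) (Or.inr rfl)]
    · rw [dφ]; simp [hzero b 1 (Or.inl rfl)]
    · rw [du]; simp [hzero _ (-1) (Or.inr rfl)]
    · rw [du]; simp [hzero _ 1 (Or.inl rfl)]
    · rw [intervalIntegral.integral_const_mul, Phi_integral, mul_zero]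
    · intro x _
      have hS : Phi l x (S 0) = Real.sin (l * x) := by simp [Phi_S]
      have : 1/2 + s * Phi l x (ψ (s^2)) - 1/2 - s * Real.sin (l * x)
          = Phi l x (ψ (s^2) - S 0) * s := by
        rw [map_sub, hS]; ring
      beta_reduce
      rw [this, abs_mul]
      exact mul_le_mul_of_nonneg_right (Phi_le l x _) (abs_nonneg s)
end

section
/- Let ε > 0 and γ > 0. Suppose ξ, u : [-1,1] → ℝ are twice continuously differentiable and satisfy: (i) ε·ξ''(x) − (36/ε)·ξ(x) − γ·u(x) = 0 for all x ∈ (−1,1); (ii) −u''(x) = ξ(x) − (1/2)∫_{-1}^{1} ξ(y) dy for all x ∈ (−1,1); (iii) ξ'(±1) = 0, u'(±1) = 0, and ∫_{-1}^{1} u(x) dx = 0. Then ξ(x) = 0 for all x ∈ [-1,1]. (Consequently the linearization of the steady Allen–Cahn–Ohta–Kawasaki operator at the constant states φ₀ = 0 and φ₀ = 1 has trivial kernel, so no bifurcation occurs from these branches.) -/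
/-- For ε > 0 and γ > 0, the linearized steady Allen–Cahn–Ohta–Kawasaki system
at the constant states φ₀ = 0 or 1, namely εξ'' − (36/ε)ξ − γu = 0 with −u'' = ξ − mean(ξ),
Neumann boundary conditions and ∫u = 0, has only the trivial solution ξ ≡ 0 on [-1,1]. -/
theorem acok_no_bifurcation_at_zero_and_one (ε γ : ℝ) (hε : 0 < ε) (hγ : 0 < γ)
    (ξ u : ℝ → ℝ) (hξ : ContDiff ℝ 2 ξ) (hu : ContDiff ℝ 2 u)
    (h1 : ∀ x ∈ Set.Ioo (-1 : ℝ) 1,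
      ε * deriv (deriv ξ) x - (36 / ε) * ξ x - γ * u x = 0)
    (h2 : ∀ x ∈ Set.Ioo (-1 : ℝ) 1,
      -(deriv (deriv u) x) = ξ x - (1 / 2) * ∫ y in (-1 : ℝ)..1, ξ y)
    (hbc₁ : deriv ξ (-1) = 0) (hbc₂ : deriv ξ 1 = 0)
    (hbc₃ : deriv u (-1) = 0) (hbc₄ : deriv u 1 = 0)
    (humean : ∫ x in (-1 : ℝ)..1, u x = 0) :
    ∀ x ∈ Set.Icc (-1 : ℝ) 1, ξ x = 0 := by
  have hξ0 : Continuous ξ := hξ.continuous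
  have hu0 : Continuous u := hu.continuous
  have hξ' : ContDiff ℝ 1 (deriv ξ) := by
    have h : ContDiff ℝ (1 + 1) ξ := by simpa [one_add_one_eq_two] using hξ
    exact (contDiff_succ_iff_deriv.mp h).2.2
  have hu' : ContDiff ℝ 1 (deriv u) := by
    have h : ContDiff ℝ (1 + 1) u := by simpa [one_add_one_eq_two] using hu
    exact (contDiff_succ_iff_deriv.mp h).2.2
  have hξ'' : Continuous (deriv (deriv ξ)) := hξ'.continuous_deriv le_rfl
  have dξ : ∀ x, HasDerivAt ξ (deriv ξ x) x := fun x =>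
    (hξ.differentiable (by norm_num) x).hasDerivAt
  have du : ∀ x, HasDerivAt u (deriv u x) x := fun x =>
    (hu.differentiable (by norm_num) x).hasDerivAt
  have dξ' : ∀ x, HasDerivAt (deriv ξ) (deriv (deriv ξ) x) x := fun x =>
    (hξ'.differentiable (by norm_num) x).hasDerivAt
  have du' : ∀ x, HasDerivAt (deriv u) (deriv (deriv u) x) x := fun x =>
    (hu'.differentiable (by norm_num) x).hasDerivAt
  have hcl : closure (Set.Ioo (-1 : ℝ) 1) = Set.Icc (-1) 1 := closure_Ioo (by norm_num)
  have h1c : Set.EqOn (fun x => ε * deriv (deriv ξ) x - (36 / ε) * ξ x - γ * u x)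
      (fun _ => 0) (Set.Icc (-1 : ℝ) 1) := by
    rw [← hcl]
    exact Set.EqOn.closure h1 (by fun_prop) (by fun_prop)
  -- the mean of ξ vanishes
  have hm : ∫ y in (-1 : ℝ)..1, ξ y = 0 := by
    have hI : ∫ x in (-1 : ℝ)..1, deriv (deriv ξ) x = 0 := by
      rw [intervalIntegral.integral_eq_sub_of_hasDerivAt (fun x _ => dξ' x)
        (hξ''.intervalIntegrable _ _), hbc₁, hbc₂, sub_zero]
    have e : ∫ x in (-1 : ℝ)..1, (ε * deriv (deriv ξ) x - (36 / ε) * ξ x - γ * u x) = 0 := by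
      rw [intervalIntegral.integral_congr (g := fun _ => (0 : ℝ))]
      · simp
      · rw [Set.uIcc_of_le (by norm_num)]
        exact h1c
    rw [intervalIntegral.integral_sub (Continuous.intervalIntegrable (by fun_prop) _ _)
      (Continuous.intervalIntegrable (by fun_prop) _ _),
      intervalIntegral.integral_sub (Continuous.intervalIntegrable (by fun_prop) _ _)
      (Continuous.intervalIntegrable (by fun_prop) _ _),
      intervalIntegral.integral_const_mul, intervalIntegral.integral_const_mul,
      intervalIntegral.integral_const_mul, hI, humean] at e
    have h36 : 36 / ε ≠ 0 := by positivity
    have e2 : 36 / ε * ∫ y in (-1 : ℝ)..1, ξ y = 0 := by linarith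
    exact (mul_eq_zero.mp e2).resolve_left h36
  rw [hm] at h2
  -- energy flux
  have dF : ∀ x, HasDerivAt (fun x => ε * (deriv ξ x * ξ x) + γ * (deriv u x * u x))
      (ε * (deriv (deriv ξ) x * ξ x + deriv ξ x * deriv ξ x)
        + γ * (deriv (deriv u) x * u x + deriv u x * deriv u x)) x := fun x =>
    (((dξ' x).mul (dξ x)).const_mul ε).add (((du' x).mul (du x)).const_mul γ)
  have key : ∀ x ∈ Set.Ioo (-1 : ℝ) 1,
      ε * (deriv (deriv ξ) x * ξ x + deriv ξ x * deriv ξ x)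
        + γ * (deriv (deriv u) x * u x + deriv u x * deriv u x)
      = (36 / ε) * ξ x ^ 2 + ε * deriv ξ x ^ 2 + γ * deriv u x ^ 2 := by
    intro x hx
    linear_combination ξ x * h1 x hx - γ * u x * h2 x hx
  have hmono : MonotoneOn (fun x => ε * (deriv ξ x * ξ x) + γ * (deriv u x * u x))
      (Set.Icc (-1 : ℝ) 1) := by
    apply monotoneOn_of_deriv_nonneg (convex_Icc _ _)
    · exact fun x _ => (dF x).continuousAt.continuousWithinAt
    · exact fun x _ => (dF x).differentiableAt.differentiableWithinAt
    · intro x hx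
      rw [interior_Icc] at hx
      rw [(dF x).deriv, key x hx]
      positivity
  have hF0 : ∀ x ∈ Set.Icc (-1 : ℝ) 1,
      ε * (deriv ξ x * ξ x) + γ * (deriv u x * u x) = 0 := by
    intro x hx
    have a := hmono (Set.left_mem_Icc.mpr (by norm_num)) hx hx.1
    have b := hmono hx (Set.right_mem_Icc.mpr (by norm_num)) hx.2
    simp only [hbc₁, hbc₂, hbc₃, hbc₄, zero_mul, mul_zero, add_zero] at a b
    exact le_antisymm b a
  have hz : Set.EqOn ξ (fun _ => 0) (Set.Ioo (-1 : ℝ) 1) := by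
    intro x hx
    have hev : (fun x => ε * (deriv ξ x * ξ x) + γ * (deriv u x * u x))
        =ᶠ[nhds x] fun _ => 0 := by
      filter_upwards [Ioo_mem_nhds hx.1 hx.2] with y hy
      exact hF0 y ⟨hy.1.le, hy.2.le⟩
    have h0 := hev.deriv_eq
    rw [(dF x).deriv, key x hx, deriv_const] at h0
    have p1 : 0 ≤ ε * deriv ξ x ^ 2 := by positivity
    have p2 : 0 ≤ γ * deriv u x ^ 2 := by positivity
    have p3 : 0 ≤ 36 / ε * ξ x ^ 2 := by positivity
    have p4 : 36 / ε * ξ x ^ 2 = 0 := by linarith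
    have h36 : 36 / ε ≠ 0 := by positivity
    exact pow_eq_zero_iff (two_ne_zero) |>.mp ((mul_eq_zero.mp p4).resolve_left h36)
  have := Set.EqOn.closure hz hξ0 continuous_const
  rw [hcl] at this
  exact this
end
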